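/- Let d ≥ 1, let c ≥ 1, and let δ ≥ 2c. For all points s, q ∈ ℝ^d with ‖s − q‖ ≥ c, the probability over (a, b) that the ternary hash indices of s and q mismatch satisfies Ψ̄(s, q) ≥ (c³/(5 δ³√(2π))) · e^{−δ²/(2c²)}; equivalently, the probability that the ternary hashes of s and q match is at most p₂(δ/c) := 1 − (1/(5 (δ/c)³ √(2π))) e^{−(δ/c)²/2}. (This is the second half of the statement that the family G_δ is a (1, c, p₁(δ), p₂(δ/c))-TLSH family.) -/

import Mathlib

open MeasureTheory ProbabilityTheory Real
open scoped ENNReal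

noncomputable section

/-- Standard inner product on `Fin d → ℝ`. -/
def dotp {d : ℕ} (a x : Fin d → ℝ) : ℝ := ∑ i, a i * x i

/-- Euclidean norm on `Fin d → ℝ`. -/
def enorm' {d : ℕ} (x : Fin d → ℝ) : ℝ := Real.sqrt (∑ i, x i ^ 2)

/-- Ternary hash index `⌊(⟨a,p⟩ + b)/δ⌋ mod 4`. -/
def hashIdx {d : ℕ} (δ : ℝ) (a : Fin d → ℝ) (b : ℝ) (p : Fin d → ℝ) : ℤ :=
  ⌊(dotp a p + b) / δ⌋ % 4

/-- `s` and `q` mismatch: one hash index is 0 (ternary symbol `0`) and the other is 2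
(ternary symbol `1`). -/
def Mismatch {d : ℕ} (δ : ℝ) (a : Fin d → ℝ) (b : ℝ) (s q : Fin d → ℝ) : Prop :=
  (hashIdx δ a b s = 0 ∧ hashIdx δ a b q = 2) ∨ (hashIdx δ a b s = 2 ∧ hashIdx δ a b q = 0)

/-- Product of `d` i.i.d. standard Gaussians: the law of `a`. -/
def gaussPi (d : ℕ) : Measure (Fin d → ℝ) := Measure.pi fun _ => gaussianReal 0 1

/-- Uniform probability measure on the interval `(0, 2δ)`: the law of `b`. -/
def unifB (δ : ℝ) : Measure ℝ :=
  (ENNReal.ofReal (2 * δ))⁻¹ • volume.restrict (Set.Ioo 0 (2 * δ))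

/-- Joint law of the independent pair `(a, b)`. -/
def jointμ (d : ℕ) (δ : ℝ) : Measure ((Fin d → ℝ) × ℝ) := (gaussPi d).prod (unifB δ)

/-- Mismatch probability `Ψ̄(s,q)` over the random pair `(a, b)`. -/
def PsiBar (d : ℕ) (δ : ℝ) (s q : Fin d → ℝ) : ℝ≥0∞ :=
  jointμ d δ {ab : (Fin d → ℝ) × ℝ | Mismatch δ ab.1 ab.2 s q}

/-- Complementary cdf `F̄` of the standard normal distribution. -/
def Fbar (y : ℝ) : ℝ := ∫ t in Set.Ioi y, (1 / Real.sqrt (2 * π)) * Real.exp (-t ^ 2 / 2)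

/-- The function `φ(y) = e^{-y²/2}/(y√(2π)) - F̄(y)`. -/
def phi (y : ℝ) : ℝ := Real.exp (-y ^ 2 / 2) / (y * Real.sqrt (2 * π)) - Fbar y

/-- One-dimensional ternary hash index `⌊(u + b)/δ⌋ mod 4`. -/
def jb (δ b u : ℝ) : ℤ := ⌊(u + b) / δ⌋ % 4

/-- One-dimensional mismatch: one index is 0 and the other is 2. -/
def Mismatch1 (δ b u v : ℝ) : Prop :=
  (jb δ b u = 0 ∧ jb δ b v = 2) ∨ (jb δ b u = 2 ∧ jb δ b v = 0)

/-- One-dimensional mismatch probability `ψ̄(u,v)` over `b` uniform on `(0, 2δ)`. -/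
def psiBar (δ u v : ℝ) : ℝ≥0∞ := unifB δ {b | Mismatch1 δ b u v}


lemma measurable_dotp {d : ℕ} (x : Fin d → ℝ) : Measurable fun a : Fin d → ℝ => dotp a x := by
  unfold dotp
  fun_prop

lemma dotp_sub {d : ℕ} (a x y : Fin d → ℝ) : dotp a (x - y) = dotp a x - dotp a y := by
  simp [dotp, mul_sub, Finset.sum_sub_distrib]

/-- A linear form in i.i.d. standard Gaussians is a scaled standard Gaussian. -/
lemma map_dotp_gaussPi {d : ℕ} (x : Fin d → ℝ) :
    (gaussPi d).map (fun a => dotp a x) = (gaussianReal 0 1).map (fun z => enorm' x * z) := by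
  have : IsProbabilityMeasure (gaussPi d) := by unfold gaussPi; infer_instance
  have : IsProbabilityMeasure ((gaussPi d).map (fun a => dotp a x)) :=
    Measure.isProbabilityMeasure_map (measurable_dotp x).aemeasurable
  rw [gaussianReal_map_const_mul]
  apply Measure.ext_of_charFun
  ext t
  rw [charFun_gaussianReal, charFun_apply_real,
    integral_map (measurable_dotp x).aemeasurable (by fun_prop)]
  have hprod (a : Fin d → ℝ) : Complex.exp (t * (dotp a x : ℝ) * Complex.I)
      = ∏ i, Complex.exp ((t * x i : ℝ) * (a i : ℝ) * Complex.I) := by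
    rw [← Complex.exp_sum]
    congr 1
    simp only [dotp, Complex.ofReal_sum, Complex.ofReal_mul, Finset.mul_sum, Finset.sum_mul]
    exact Finset.sum_congr rfl fun i _ => by ring
  simp_rw [hprod]
  unfold gaussPi
  rw [integral_fintype_prod_eq_prod
    (f := fun i (y : ℝ) => Complex.exp ((t * x i : ℝ) * (y : ℝ) * Complex.I))]
  simp_rw [← charFun_apply_real, charFun_gaussianReal]
  rw [← Complex.exp_sum]
  congr 1
  have hsq : enorm' x ^ 2 = ∑ i, x i ^ 2 := Real.sq_sqrt (Finset.sum_nonneg fun i _ => sq_nonneg _)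
  simp only [Complex.ofReal_zero, mul_zero, zero_mul, zero_sub, NNReal.coe_one,
    NNReal.coe_mk, hsq, mul_one, Complex.ofReal_sum, Complex.ofReal_mul, Complex.ofReal_pow,
    Complex.ofReal_one, one_mul, Finset.sum_neg_distrib, Finset.sum_mul, Finset.sum_div]
  congr 1
  exact Finset.sum_congr rfl fun i _ => by ring

lemma measurableSet_mismatch {d : ℕ} (δ : ℝ) (s q : Fin d → ℝ) :
    MeasurableSet {ab : (Fin d → ℝ) × ℝ | Mismatch δ ab.1 ab.2 s q} := by
  have key (p : Fin d → ℝ) (k : ℤ) :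
      MeasurableSet {ab : (Fin d → ℝ) × ℝ | hashIdx δ ab.1 ab.2 p = k} := by
    have h1 : Measurable fun ab : (Fin d → ℝ) × ℝ => ⌊(dotp ab.1 p + ab.2) / δ⌋ :=
      ((((measurable_dotp p).comp measurable_fst).add measurable_snd).div_const δ).floor
    exact (measurable_from_top (f := fun n : ℤ => n % 4)).comp h1 (measurableSet_singleton k)
  exact ((key s 0).inter (key q 2)).union ((key s 2).inter (key q 0))

lemma measurableSet_mismatch1 (δ u v : ℝ) : MeasurableSet {b | Mismatch1 δ b u v} := by
  have key (p : ℝ) (k : ℤ) : MeasurableSet {b : ℝ | jb δ b p = k} := by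
    have h1 : Measurable fun b : ℝ => ⌊(p + b) / δ⌋ :=
      ((measurable_const.add measurable_id).div_const δ).floor
    exact (measurable_from_top (f := fun n : ℤ => n % 4)).comp h1 (measurableSet_singleton k)
  exact ((key u 0).inter (key v 2)).union ((key u 2).inter (key v 0))

lemma mismatch1_add_period {δ : ℝ} (hδ : 0 < δ) (b u v : ℝ) :
    Mismatch1 δ (b + 2 * δ) u v ↔ Mismatch1 δ b u v := by
  have key (p : ℝ) : ⌊(p + (b + 2 * δ)) / δ⌋ = ⌊(p + b) / δ⌋ + 2 := by
    have : (p + (b + 2 * δ)) / δ = (p + b) / δ + (2 : ℤ) := by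
      field_simp
      push_cast
      ring
    rw [this, Int.floor_add_intCast]
  simp only [Mismatch1, jb, key]
  omega

/-- The set of mismatching offsets has the same measure in every window of one period. -/
lemma psiBar_eq_window {δ : ℝ} (hδ : 0 < δ) (u v c : ℝ) :
    psiBar δ u v = (ENNReal.ofReal (2 * δ))⁻¹ *
      volume ({b | Mismatch1 δ b u v} ∩ Set.Ioc c (c + 2 * δ)) := by
  set A := {b | Mismatch1 δ b u v} with hA
  have hm : MeasurableSet A := measurableSet_mismatch1 δ u v
  have hper : Function.Periodic (A.indicator (fun _ => (1 : ℝ))) (2 * δ) := by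
    intro b
    by_cases hb : b ∈ A
    · have hb' : b + 2 * δ ∈ A := (mismatch1_add_period hδ b u v).2 hb
      simp [hb, hb']
    · have hb' : b + 2 * δ ∉ A := fun h => hb ((mismatch1_add_period hδ b u v).1 h)
      simp [hb, hb']
  have hint (x : ℝ) : ∫ b in x..x + 2 * δ, A.indicator (fun _ => (1 : ℝ)) b
      = volume.real (A ∩ Set.Ioc x (x + 2 * δ)) := by
    rw [intervalIntegral.integral_of_le (by linarith), integral_indicator hm]
    simp [measureReal_def, Measure.restrict_apply hm]
  have h := hper.intervalIntegral_add_eq 0 c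
  have hfin (x : ℝ) : volume (A ∩ Set.Ioc x (x + 2 * δ)) ≠ ⊤ :=
    ((measure_mono Set.inter_subset_right).trans_lt measure_Ioc_lt_top).ne
  rw [hint, hint, measureReal_eq_measureReal_iff (hfin _) (hfin _), zero_add] at h
  rw [← h, psiBar, unifB, Measure.smul_apply, smul_eq_mul,
    Measure.restrict_congr_set Ioo_ae_eq_Ioc, Measure.restrict_apply hm]

/-- The one-dimensional mismatch probability dominates the tent of height `1/2` and half-width
`1` centred at any integer congruent to `2` modulo `4`. -/
lemma tent_le_psiBar {δ : ℝ} (hδ : 0 < δ) (u v : ℝ) (k : ℤ) :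
    ENNReal.ofReal ((1 - |(u - v) / δ - 2 - 4 * k|) / 2) ≤ psiBar δ u v := by
  set τ := (u - v) / δ - 2 - 4 * k with hτ
  rw [psiBar_eq_window hδ u v (-u)]
  have hsub : Set.Ioo (δ * max 0 τ - u) (δ * min 1 (1 + τ) - u) ⊆
      {b | Mismatch1 δ b u v} ∩ Set.Ioc (-u) (-u + 2 * δ) := by
    rintro b ⟨h1, h2⟩
    have hw1 : max 0 τ < (u + b) / δ := by rw [lt_div_iff₀ hδ]; linarith
    have hw2 : (u + b) / δ < min 1 (1 + τ) := by rw [div_lt_iff₀ hδ]; linarith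
    rw [max_lt_iff] at hw1
    rw [lt_min_iff] at hw2
    have hv : (v + b) / δ = (u + b) / δ - τ + ((-2 - 4 * k : ℤ) : ℝ) := by
      rw [hτ]
      push_cast
      field_simp
      ring
    have hfu : ⌊(u + b) / δ⌋ = 0 := Int.floor_eq_zero_iff.2 ⟨hw1.1.le, hw2.1⟩
    have hfv : ⌊(v + b) / δ⌋ = -2 - 4 * k := by
      rw [hv, Int.floor_add_intCast,
        Int.floor_eq_zero_iff.2 ⟨by linarith, by linarith⟩, zero_add]
    refine ⟨Or.inl ⟨by simp [jb, hfu], by simp only [jb, hfv]; omega⟩, ?_, ?_⟩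
    · have := (lt_div_iff₀ hδ).1 hw1.1
      linarith
    · have := (div_lt_iff₀ hδ).1 hw2.1
      linarith
  refine le_trans ?_ (mul_le_mul_right (measure_mono hsub) _)
  rw [Real.volume_Ioo, ← ENNReal.ofReal_inv_of_pos (by positivity),
    ← ENNReal.ofReal_mul (by positivity)]
  apply ENNReal.ofReal_le_ofReal
  have : min 1 (1 + τ) - max 0 τ = 1 - |τ| := by
    rcases le_total 0 τ with h | h
    · rw [abs_of_nonneg h, max_eq_right h, min_eq_left (by linarith)]
    · rw [abs_of_nonpos h, max_eq_left h, min_eq_right (by linarith)]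
      ring
  rw [← this]
  apply le_of_eq
  field_simp
  ring

lemma ofReal_integral_le_lintegral {α : Type*} [MeasurableSpace α] {μ : Measure α} {f : α → ℝ}
    (hf : Integrable f μ) : ENNReal.ofReal (∫ x, f x ∂μ) ≤ ∫⁻ x, ENNReal.ofReal (f x) ∂μ := by
  have h := ofReal_integral_eq_lintegral_ofReal hf.pos_part
    (Filter.Eventually.of_forall fun x => le_max_right _ _)
  simp only [ENNReal.ofReal_max, ENNReal.ofReal_zero, zero_le, max_eq_left] at h
  rw [← h]
  exact ENNReal.ofReal_le_ofReal
    (integral_mono hf hf.pos_part fun x => le_max_left _ _)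

/-- A pointwise lower bound on the one-dimensional mismatch probability integrates to a lower bound
on the mismatch probability. -/
lemma ofReal_integral_le_PsiBar {d : ℕ} {δ : ℝ} (s q : Fin d → ℝ) {f : ℝ → ℝ} (hfm : Measurable f)
    (hf : ∀ u v, ENNReal.ofReal (f ((u - v) / δ)) ≤ psiBar δ u v)
    (hint : Integrable (fun z => f (enorm' (s - q) * z / δ)) (gaussianReal 0 1)) :
    ENNReal.ofReal (∫ z, f (enorm' (s - q) * z / δ) ∂gaussianReal 0 1) ≤ PsiBar d δ s q := by
  have : SFinite (unifB δ) := by unfold unifB; infer_instance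
  have hm : Measurable fun y : ℝ => ENNReal.ofReal (f (y / δ)) := by fun_prop
  refine (ofReal_integral_le_lintegral hint).trans ?_
  rw [← lintegral_map (f := fun y => ENNReal.ofReal (f (y / δ)))
    (g := fun z => enorm' (s - q) * z) hm (by fun_prop), ← map_dotp_gaussPi,
    lintegral_map hm (measurable_dotp _), PsiBar, jointμ,
    Measure.prod_apply (measurableSet_mismatch δ s q)]
  refine lintegral_mono fun a => ?_
  rw [dotp_sub]
  exact hf _ _

lemma integral_cos_gaussianReal (α : ℝ) :
    ∫ z, Real.cos (α * z) ∂gaussianReal 0 1 = Real.exp (-α ^ 2 / 2) := by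
  have h := charFun_gaussianReal (μ := 0) (v := 1) α
  rw [charFun_apply_real] at h
  have hint : Integrable (fun z : ℝ => Complex.exp (α * z * Complex.I)) (gaussianReal 0 1) := by
    refine Integrable.of_bound (by fun_prop) 1 (Filter.Eventually.of_forall fun z => ?_)
    rw [← Complex.ofReal_mul, Complex.norm_exp_ofReal_mul_I]
  have hre := congrArg Complex.re h
  rw [← RCLike.re_eq_complex_re, ← integral_re hint] at hre
  have e1 (z : ℝ) : RCLike.re (Complex.exp (α * z * Complex.I)) = Real.cos (α * z) := by
    rw [RCLike.re_eq_complex_re, ← Complex.ofReal_mul, Complex.exp_ofReal_mul_I_re]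
  simp_rw [e1] at hre
  rw [hre, RCLike.re_eq_complex_re, ← Complex.exp_ofReal_re]
  congr 2
  push_cast
  ring

/-- A trigonometric minorant of the one-dimensional mismatch probability. -/
lemma trig_le_psiBar {δ : ℝ} (hδ : 0 < δ) (u v : ℝ) :
    ENNReal.ofReal (1 / (2 * π) * (Real.cos (π / 2 * ((u - v) / δ)) ^ 2
      - Real.cos (π / 2 * ((u - v) / δ)))) ≤ psiBar δ u v := by
  set t := (u - v) / δ with ht
  set k := ⌊t / 4⌋ with hk
  set τ := t - 2 - 4 * k with hτ
  refine le_trans (ENNReal.ofReal_le_ofReal_iff'.2 ?_) (tent_le_psiBar hδ u v k)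
  rw [← ht, ← hτ]
  have hτ1 : -2 ≤ τ := by
    have := Int.floor_le (t / 4)
    linarith
  have hτ2 : τ ≤ 2 := by
    have := Int.lt_floor_add_one (t / 4)
    linarith
  have hcos : Real.cos (π / 2 * t) = -Real.cos (π / 2 * |τ|) := by
    have h1 : Real.cos (π / 2 * |τ|) = Real.cos (π / 2 * τ) := by
      rcases abs_choice τ with h | h <;> simp [h]
    rw [h1, ← Real.cos_add_pi, ← Real.cos_add_int_mul_two_pi (π / 2 * τ + π) k]
    congr 1
    rw [hτ]
    ring
  have habs : |τ| ≤ 2 := abs_le.2 ⟨hτ1, hτ2⟩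
  have hπ := Real.pi_pos
  rw [hcos]
  set C := Real.cos (π / 2 * |τ|) with hC
  have hC1 : C ≤ 1 := Real.cos_le_one _
  have hC2 : -1 ≤ C := Real.neg_one_le_cos _
  rcases le_total |τ| 1 with h | h
  · left
    have hC0 : 0 ≤ C := Real.cos_nonneg_of_neg_pi_div_two_le_of_le
      (by nlinarith [abs_nonneg τ]) (by nlinarith)
    have hC3 : C ≤ π / 2 * (1 - |τ|) := by
      rw [hC, ← Real.sin_pi_div_two_sub]
      refine (Real.sin_le (by nlinarith)).trans (by linarith)
    rw [div_mul_eq_mul_div, one_mul, div_le_iff₀ (by positivity)]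
    nlinarith
  · right
    have hC0 : C ≤ 0 := Real.cos_nonpos_of_pi_div_two_le_of_le (by nlinarith) (by nlinarith)
    have : (-C) ^ 2 - -C ≤ 0 := by nlinarith
    exact mul_nonpos_of_nonneg_of_nonpos (by positivity) this

lemma trig_bound_le_PsiBar {d : ℕ} {δ : ℝ} (hδ : 0 < δ) (s q : Fin d → ℝ) :
    ENNReal.ofReal (1 / (2 * π) *
      (1 / 2 - Real.exp (-(π / 2 * (enorm' (s - q) / δ)) ^ 2 / 2))) ≤ PsiBar d δ s q := by
  set α := π / 2 * (enorm' (s - q) / δ) with hα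
  have harg (z : ℝ) : π / 2 * (enorm' (s - q) * z / δ) = α * z := by rw [hα]; ring
  have hcos (β : ℝ) : Integrable (fun z => Real.cos (β * z)) (gaussianReal 0 1) :=
    Integrable.of_bound (by fun_prop) 1
      (Filter.Eventually.of_forall fun z => Real.abs_cos_le_one _)
  have hsq (z : ℝ) : 1 / (2 * π) * (Real.cos (π / 2 * (enorm' (s - q) * z / δ)) ^ 2
      - Real.cos (π / 2 * (enorm' (s - q) * z / δ)))
      = 1 / (2 * π) * (1 / 2 + 1 / 2 * Real.cos (2 * α * z) - Real.cos (α * z)) := by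
    rw [harg, Real.cos_sq, mul_assoc 2 α z]
    ring
  have hi1 : Integrable (fun z => 1 / 2 + 1 / 2 * Real.cos (2 * α * z)) (gaussianReal 0 1) :=
    (integrable_const _).add ((hcos _).const_mul _)
  refine le_trans (ENNReal.ofReal_le_ofReal ?_)
    (ofReal_integral_le_PsiBar (f := fun t => 1 / (2 * π) * (Real.cos (π / 2 * t) ^ 2
      - Real.cos (π / 2 * t))) s q (by fun_prop) (trig_le_psiBar hδ) ?_)
  · simp_rw [hsq]
    rw [integral_const_mul, integral_sub hi1 (hcos _),
      integral_add (integrable_const _) ((hcos _).const_mul _), integral_const_mul,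
      integral_cos_gaussianReal, integral_cos_gaussianReal]
    refine mul_le_mul_of_nonneg_left ?_ (by positivity)
    have := Real.exp_pos (-(2 * α) ^ 2 / 2)
    simp only [integral_const, probReal_univ, smul_eq_mul]
    linarith
  · simp_rw [hsq]
    exact (hi1.sub (hcos _)).const_mul _

/-- The two tents around `0` are a minorant of the one-dimensional mismatch probability. -/
lemma two_tents_le_psiBar {δ : ℝ} (hδ : 0 < δ) (u v : ℝ) :
    ENNReal.ofReal (max 0 ((1 - |(|(u - v) / δ|) - 2|) / 2)) ≤ psiBar δ u v := by
  rw [ENNReal.ofReal_max, ENNReal.ofReal_zero, max_eq_right (zero_le)]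
  rcases le_total 0 ((u - v) / δ) with h | h
  · have := tent_le_psiBar hδ u v 0
    rwa [Int.cast_zero, mul_zero, sub_zero, ← abs_of_nonneg h] at this
  · have := tent_le_psiBar hδ u v (-1)
    rw [abs_of_nonpos h, ← abs_neg]
    convert this using 5
    push_cast
    ring

lemma mul_sub_le_exp_neg {x : ℝ} (hx : x ≤ 1.84) : 0.42 * (1.84 - x) ≤ Real.exp (-x) := by
  have h1 : Real.exp (-x) = Real.exp (0.16 - 1) * Real.exp (0.84 - x) := by
    rw [← Real.exp_add]
    ring_nf
  have h2 : (1.84 - x) ≤ Real.exp (0.84 - x) := by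
    have := Real.add_one_le_exp (0.84 - x)
    linarith
  have h3 : (0.42 : ℝ) ≤ Real.exp (0.16 - 1) := by
    rw [Real.exp_sub, le_div_iff₀ (Real.exp_pos _)]
    have := Real.add_one_le_exp (0.16 : ℝ)
    have := Real.exp_one_lt_d9
    linarith
  rw [h1]
  exact mul_le_mul h3 h2 (by linarith) (Real.exp_pos _).le

lemma le_integral_two_tents {r : ℝ} (hr : 6 / 5 ≤ r) :
    (√(2 * π))⁻¹ * Real.exp (-r ^ 2 / 2) / (5 * r ^ 3)
      ≤ ∫ z, max 0 ((1 - |(|z / r|) - 2|) / 2) ∂gaussianReal 0 1 := by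
  have hr0 : 0 < r := by linarith
  rw [integral_gaussianReal_eq_integral_smul one_ne_zero]
  set F : ℝ → ℝ := fun z => (√(2 * π))⁻¹ * Real.exp (-z ^ 2 / 2) *
    max 0 ((1 - |z / r - 2|) / 2) with hF
  have hFc : Continuous F := by fun_prop
  have hF0 (z : ℝ) : 0 ≤ F z := by positivity
  have heq : (fun z => gaussianPDFReal 0 1 z • max 0 ((1 - |(|z / r|) - 2|) / 2))
      = fun z => F |z| := by
    ext z
    simp [hF, gaussianPDFReal, abs_div, abs_of_pos hr0]
  rw [heq, integral_comp_abs]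
  have hFint : Integrable F := by
    have h1 : Integrable (fun z => (√(2 * π))⁻¹ * Real.exp (-z ^ 2 / 2)) := by
      simpa [gaussianPDFReal_def] using integrable_gaussianPDFReal 0 1
    refine h1.smul_of_top_left (f := fun z => max 0 ((1 - |z / r - 2|) / 2)) ?_
    refine memLp_top_of_bound (by fun_prop) 1 (Filter.Eventually.of_forall fun z => ?_)
    rw [Real.norm_eq_abs, abs_of_nonneg (le_max_left _ _)]
    refine max_le zero_le_one ?_
    linarith [abs_nonneg (z / r - 2)]
  have hle : r ≤ 1 / r + r := by
    have : 0 < 1 / r := by positivity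
    linarith
  have hrr : 1 / r ≤ r := by
    rw [div_le_iff₀ hr0]
    nlinarith
  set A := (√(2 * π))⁻¹ * Real.exp (-r ^ 2 / 2) * (0.42 / (2 * r)) with hA
  have hstep : A * (0.92 / r ^ 2 - 1 / (3 * r ^ 2) - 1 / (8 * r ^ 4)) ≤ ∫ z in Set.Ioi 0, F z := by
    calc A * (0.92 / r ^ 2 - 1 / (3 * r ^ 2) - 1 / (8 * r ^ 4))
        = ∫ h in (0 : ℝ)..1 / r, A * (1.84 * h - r * h ^ 2 - 1 / 2 * h ^ 3) := by
          rw [intervalIntegral.integral_const_mul, intervalIntegral.integral_sub,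
            intervalIntegral.integral_sub, intervalIntegral.integral_const_mul,
            intervalIntegral.integral_const_mul, intervalIntegral.integral_const_mul, integral_id,
            integral_pow, integral_pow]
          · congr 1
            norm_num
            field_simp
            ring
          all_goals exact Continuous.intervalIntegrable (by fun_prop) _ _
      _ = ∫ z in r..(1 / r + r),
            A * (1.84 * (z - r) - r * (z - r) ^ 2 - 1 / 2 * (z - r) ^ 3) := by
          rw [intervalIntegral.integral_comp_sub_right
            (fun h => A * (1.84 * h - r * h ^ 2 - 1 / 2 * h ^ 3)) r]
          simp
      _ ≤ ∫ z in r..(1 / r + r), F z := by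
          refine intervalIntegral.integral_mono_on hle
            (Continuous.intervalIntegrable (by fun_prop) _ _) (hFc.intervalIntegrable _ _) ?_
          rintro z ⟨hz1, hz2⟩
          obtain ⟨h, rfl⟩ : ∃ h, z = r + h := ⟨z - r, by ring⟩
          have h0 : 0 ≤ h := by linarith
          have hh : h ≤ 1 / r := by linarith
          have hrh : r * h ≤ 1 := by
            rw [le_div_iff₀ hr0] at hh
            linarith
          have hh1 : h ≤ 5 / 6 := by nlinarith
          have hexp : Real.exp (-(r + h) ^ 2 / 2)
              = Real.exp (-r ^ 2 / 2) * Real.exp (-(r * h + h ^ 2 / 2)) := by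
            rw [← Real.exp_add]
            ring_nf
          have htent : h / (2 * r) ≤ max 0 ((1 - |(r + h) / r - 2|) / 2) := by
            refine le_trans (le_of_eq ?_) (le_max_right _ _)
            rw [abs_of_nonpos]
            · field_simp
              ring
            · rw [sub_nonpos, div_le_iff₀ hr0]
              linarith
          have hb := mul_sub_le_exp_neg (x := r * h + h ^ 2 / 2) (by nlinarith)
          calc A * (1.84 * (r + h - r) - r * (r + h - r) ^ 2 - 1 / 2 * (r + h - r) ^ 3)
              = (√(2 * π))⁻¹ * (Real.exp (-r ^ 2 / 2) * (0.42 * (1.84 - (r * h + h ^ 2 / 2))))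
                  * (h / (2 * r)) := by
                rw [hA]
                ring
            _ ≤ F (r + h) := by
                simp only [hF, hexp]
                gcongr
      _ ≤ ∫ z in Set.Ioi 0, F z := by
          rw [intervalIntegral.integral_of_le hle]
          exact setIntegral_mono_set hFint.integrableOn (Filter.Eventually.of_forall hF0)
            (Filter.Eventually.of_forall fun z hz => hr0.trans hz.1)
  refine le_trans ?_ (mul_le_mul_of_nonneg_left hstep zero_le_two)
  have hfin : 2 * (A * (0.92 / r ^ 2 - 1 / (3 * r ^ 2) - 1 / (8 * r ^ 4)))
      = (√(2 * π))⁻¹ * Real.exp (-r ^ 2 / 2) / (5 * r ^ 3)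
        * (2.1 * (0.92 - 1 / 3 - 1 / 8 * (1 / r) ^ 2)) := by
    rw [hA]
    field_simp
    ring
  rw [hfin]
  refine le_mul_of_one_le_right (by positivity) ?_
  have hinv : 1 / r ≤ 5 / 6 := by
    rw [div_le_div_iff₀ hr0 (by norm_num)]
    linarith
  have : (1 / r) ^ 2 ≤ (5 / 6) ^ 2 := by gcongr
  linarith

lemma tents_bound_le_PsiBar {d : ℕ} {δ : ℝ} (hδ : 0 < δ) (s q : Fin d → ℝ)
    (hs : 0 < enorm' (s - q)) (hr : 6 / 5 ≤ δ / enorm' (s - q)) :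
    ENNReal.ofReal ((√(2 * π))⁻¹ * Real.exp (-(δ / enorm' (s - q)) ^ 2 / 2)
      / (5 * (δ / enorm' (s - q)) ^ 3)) ≤ PsiBar d δ s q := by
  have harg (z : ℝ) : enorm' (s - q) * z / δ = z / (δ / enorm' (s - q)) := by
    field_simp
  refine le_trans (ENNReal.ofReal_le_ofReal ?_)
    (ofReal_integral_le_PsiBar (f := fun t => max 0 ((1 - |(|t|) - 2|) / 2)) s q (by fun_prop)
      (two_tents_le_psiBar hδ) ?_)
  · simp_rw [harg]
    exact le_integral_two_tents hr
  · refine Integrable.of_bound (by fun_prop) 1 (Filter.Eventually.of_forall fun z => ?_)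
    rw [Real.norm_eq_abs, abs_of_nonneg (le_max_left _ _)]
    refine max_le zero_le_one ?_
    linarith [abs_nonneg (|enorm' (s - q) * z / δ| - 2)]

/-- for `δ ≥ 2c`, `c ≥ 1`, points at distance at least `c` mismatch with
probability at least `(c³/(5δ³√(2π))) e^{-δ²/(2c²)}`. -/
theorem tlsh_far_pair_mismatch_bound (d : ℕ) (hd : 1 ≤ d) (c δ : ℝ) (hc : 1 ≤ c)
    (hδ : 2 * c ≤ δ) (s q : Fin d → ℝ) (h : c ≤ enorm' (s - q)) :
    ENNReal.ofReal (c ^ 3 / (5 * δ ^ 3 * Real.sqrt (2 * π)) * Real.exp (-δ ^ 2 / (2 * c ^ 2)))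
      ≤ PsiBar d δ s q := by
  have hc0 : 0 < c := by linarith
  have hδ0 : 0 < δ := by linarith
  set σ := enorm' (s - q) with hσ
  have hσ0 : 0 < σ := by linarith
  have hroot : 0 < √(2 * π) := by positivity
  rcases le_total (6 / 5) (δ / σ) with hr | hr
  · refine le_trans (ENNReal.ofReal_le_ofReal ?_) (tents_bound_le_PsiBar hδ0 s q hσ0 hr)
    rw [← hσ]
    calc c ^ 3 / (5 * δ ^ 3 * √(2 * π)) * Real.exp (-δ ^ 2 / (2 * c ^ 2))
        = c ^ 3 / (5 * δ ^ 3 * √(2 * π)) * Real.exp (-(δ ^ 2 / (2 * c ^ 2))) := by rw [neg_div]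
      _ ≤ σ ^ 3 / (5 * δ ^ 3 * √(2 * π)) * Real.exp (-(δ ^ 2 / (2 * σ ^ 2))) := by gcongr
      _ = (√(2 * π))⁻¹ * Real.exp (-(δ / σ) ^ 2 / 2) / (5 * (δ / σ) ^ 3) := by
          rw [show -(δ / σ) ^ 2 / 2 = -(δ ^ 2 / (2 * σ ^ 2)) by field_simp]
          field_simp
  · refine le_trans (ENNReal.ofReal_le_ofReal ?_) (trig_bound_le_PsiBar hδ0 s q)
    rw [← hσ]
    have hexp : Real.exp (-(π / 2 * (σ / δ)) ^ 2 / 2) ≤ 0.46 := by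
      have h1 : 5 / 6 ≤ σ / δ := by
        rw [div_le_div_iff₀ (by norm_num) hδ0]
        rw [div_le_div_iff₀ hσ0 (by norm_num)] at hr
        linarith
      have h2 : 1.3 ≤ π / 2 * (σ / δ) := by nlinarith [Real.pi_gt_d2]
      have h3 : 0.845 ≤ (π / 2 * (σ / δ)) ^ 2 / 2 := by nlinarith
      have h4 := Real.quadratic_le_exp_of_nonneg (x := 0.845) (by norm_num)
      have h5 := Real.exp_le_exp.2 h3
      rw [neg_div, Real.exp_neg]
      exact inv_le_of_inv_le₀ (by norm_num) (le_trans (by norm_num at h4 ⊢; linarith) h5)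
    have hcδ : c ^ 3 / (5 * δ ^ 3 * √(2 * π)) ≤ 1 / (40 * √(2 * π)) := by
      have : (2 * c) ^ 3 ≤ δ ^ 3 := by gcongr
      rw [div_le_div_iff₀ (by positivity) (by positivity)]
      nlinarith
    have hexp2 : Real.exp (-δ ^ 2 / (2 * c ^ 2)) ≤ 1 / 3 := by
      have h1 : 2 ≤ δ ^ 2 / (2 * c ^ 2) := by
        rw [le_div_iff₀ (by positivity)]
        nlinarith
      have h2 := Real.add_one_le_exp (δ ^ 2 / (2 * c ^ 2))
      rw [neg_div, Real.exp_neg, one_div]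
      exact inv_anti₀ (by norm_num) (by linarith)
    have hsq : √(2 * π) ^ 2 = 2 * π := Real.sq_sqrt (by positivity)
    have hle : √(2 * π) ≤ 4 := Real.sqrt_le_iff.2 ⟨by norm_num, by linarith [Real.pi_le_four]⟩
    calc c ^ 3 / (5 * δ ^ 3 * √(2 * π)) * Real.exp (-δ ^ 2 / (2 * c ^ 2))
        ≤ 1 / (40 * √(2 * π)) * (1 / 3) := by gcongr
      _ ≤ 1 / (2 * π) * 0.04 := by
          have hR : 1 / (2 * π) = 1 / √(2 * π) ^ 2 := by rw [hsq]
          rw [hR, div_mul_div_comm, div_mul_eq_mul_div,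
            div_le_div_iff₀ (by positivity) (by positivity)]
          nlinarith
      _ ≤ _ := by
          gcongr
          linarith

end
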